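/- Let N = 2. Then for every integer k ≥ 0 and every p with 1 ≤ p ≤ ∞, the Lyapunov constant γ_{p,k} is strictly positive if and only if 1 < p ≤ ∞ (in particular γ_{1,k} = 0). -/

import Mathlib

open MeasureTheory Set Filter

noncomputable section

/-- The measure of the (N-1)-dimensional unit sphere in `ℝ^N`. -/
def omegaN (N : ℕ) : ℝ :=
  N * (volume (Metric.ball (0 : EuclideanSpace ℝ (Fin N)) 1)).toReal

/-- `u` is a radial Neumann solution of `Δu + a u = 0` on the unit ball of `ℝ^N`,
with explicit derivative function `u'` : `u` is continuous on `[0,1]`, differentiable on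
`(0,1]`, satisfies the integrated radial equation
`r^(N-1) u'(r) = -∫_0^r s^(N-1) a(s) u(s) ds` on `(0,1]`, and `u'(1) = 0`. -/
def IsRadialNeumannSolutionDeriv (N : ℕ) (a u u' : ℝ → ℝ) : Prop :=
  ContinuousOn u (Icc 0 1) ∧
  (∀ r ∈ Ioc (0:ℝ) 1, HasDerivAt u (u' r) r) ∧
  (∀ r ∈ Ioc (0:ℝ) 1,
    r ^ (N - 1) * u' r = - ∫ s in (0:ℝ)..r, s ^ (N - 1) * a s * u s) ∧
  u' 1 = 0

/-- `u` is a radial Neumann solution of `Δu + a u = 0` on the unit ball of `ℝ^N`. -/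
def IsRadialNeumannSolution (N : ℕ) (a u : ℝ → ℝ) : Prop :=
  ∃ u' : ℝ → ℝ, IsRadialNeumannSolutionDeriv N a u u'

/-- `u` is not identically zero on `[0,1]`. -/
def NontrivialSol (u : ℝ → ℝ) : Prop := ∃ r ∈ Icc (0:ℝ) 1, u r ≠ 0

/-- `μ ≺ a` : `a(r) ≥ μ` for a.e. `r ∈ (0,1)` and `a(r) > μ` on a set of positive measure. -/
def Prec (μ : ℝ) (a : ℝ → ℝ) : Prop :=
  (∀ᵐ r ∂(volume.restrict (Ioo (0:ℝ) 1)), μ ≤ a r) ∧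
  0 < volume {r ∈ Ioo (0:ℝ) 1 | μ < a r}

/-- A radial function `a` belongs to `L^p(B_1)` (finite `p`). -/
def RadialMemLp (N : ℕ) (p : ℝ) (a : ℝ → ℝ) : Prop :=
  IntegrableOn (fun r => r ^ (N - 1) * |a r| ^ p) (Ioo (0:ℝ) 1)

/-- A radial function `a` belongs to `L^∞(B_1)`. -/
def RadialMemLinfty (a : ℝ → ℝ) : Prop :=
  ∃ C : ℝ, ∀ᵐ r ∂(volume.restrict (Ioo (0:ℝ) 1)), |a r| ≤ C

/-- The `L^p(B_1)` norm of a radial function (finite `p`):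
`(ω_N ∫_0^1 r^(N-1) |a(r)|^p dr)^(1/p)`. -/
def radialLpNorm (N : ℕ) (p : ℝ) (a : ℝ → ℝ) : ℝ :=
  (omegaN N * ∫ r in (0:ℝ)..1, r ^ (N - 1) * |a r| ^ p) ^ (1 / p)

/-- The `L^∞(B_1)` norm of a radial function: essential supremum of `|a|` on `(0,1)`. -/
def radialLinftyNorm (a : ℝ → ℝ) : ℝ :=
  essSup (fun r => |a r|) (volume.restrict (Ioo (0:ℝ) 1))

/-- The admissible class `Γ_k` at level `μk`: radial measurable `a` with `μk ≺ a`, such that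
`Δu + a u = 0` has a nontrivial radial Neumann solution, and `a ∈ L^{N/2}(B_1)` if `N ≥ 3`,
or `a ∈ L^q(B_1)` for some `q ∈ (1,∞]` if `N = 2`. -/
def GammaSet (N : ℕ) (μk : ℝ) (a : ℝ → ℝ) : Prop :=
  Measurable a ∧ Prec μk a ∧
  (∃ u : ℝ → ℝ, IsRadialNeumannSolution N a u ∧ NontrivialSol u) ∧
  (if 3 ≤ N then RadialMemLp N ((N : ℝ) / 2) a
   else (∃ q : ℝ, 1 < q ∧ RadialMemLp N q a) ∨ RadialMemLinfty a)

/-- The Lyapunov constant `γ_{p,k}` for finite `p`. -/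
def gammaLyap (N : ℕ) (μk : ℝ) (p : ℝ) : ℝ :=
  sInf {t : ℝ | ∃ a : ℝ → ℝ, GammaSet N μk a ∧ RadialMemLp N p a ∧
    t = radialLpNorm N p (fun r => a r - μk)}

/-- The Lyapunov constant `γ_{∞,k}`. -/
def gammaLyapInfty (N : ℕ) (μk : ℝ) : ℝ :=
  sInf {t : ℝ | ∃ a : ℝ → ℝ, GammaSet N μk a ∧ RadialMemLinfty a ∧
    t = radialLinftyNorm (fun r => a r - μk)}

/-- `(μ, φ)` is the `k`-th radial Neumann eigenpair of `-Δ` on `B_1 ⊆ ℝ^N`: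
`μ ≥ 0`, `φ` is a nontrivial radial Neumann solution of `Δφ + μ φ = 0` having exactly `k`
zeros in `(0,1)`, all simple, given by `rz k < rz (k-1) < ⋯ < rz 1`. -/
def IsRadialNeumannEigenpair (N k : ℕ) (μ : ℝ) (φ : ℝ → ℝ) (rz : ℕ → ℝ) : Prop :=
  0 ≤ μ ∧
  IsRadialNeumannSolution N (fun _ => μ) φ ∧ NontrivialSol φ ∧
  (∀ i, 1 ≤ i → i ≤ k → rz i ∈ Ioo (0:ℝ) 1) ∧
  (∀ i j, 1 ≤ i → i < j → j ≤ k → rz j < rz i) ∧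
  (∀ x ∈ Ioo (0:ℝ) 1, (φ x = 0 ↔ ∃ i, 1 ≤ i ∧ i ≤ k ∧ x = rz i)) ∧
  (∀ i, 1 ≤ i → i ≤ k → ∃ d : ℝ, d ≠ 0 ∧ HasDerivAt φ d (rz i))

/-- `u` (with derivative `u'`) is a radial `H^1` solution of `Δu + a u = 0` in `B_1`:
continuous on `(0,1]`, differentiable on `(0,1)`, satisfying the integrated radial equation
between any two radii, with finite radial `H^1` energy. -/
def IsRadialH1Solution (N : ℕ) (a u u' : ℝ → ℝ) : Prop :=
  ContinuousOn u (Ioc 0 1) ∧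
  (∀ r ∈ Ioo (0:ℝ) 1, HasDerivAt u (u' r) r) ∧
  (∀ s ∈ Ioo (0:ℝ) 1, ∀ r ∈ Ioo (0:ℝ) 1, s < r →
    r ^ (N - 1) * u' r - s ^ (N - 1) * u' s
      = - ∫ t in s..r, t ^ (N - 1) * a t * u t) ∧
  IntegrableOn (fun r => r ^ (N - 1) * ((u' r) ^ 2 + (u r) ^ 2)) (Ioo (0:ℝ) 1)

/-- The Sobolev quotient: infimum of `(∫_{B_ρ} |∇w|²) / (∫_{B_ρ} |w|^q)^{2/q}` over nontrivial
`C^1` functions `w : ℝ^N → ℝ` with compact support contained in the ball `B_ρ`. -/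
def sobolevQuot (N : ℕ) (q : ℝ) (ρ : ℝ) : ℝ :=
  sInf {t : ℝ | ∃ w : EuclideanSpace ℝ (Fin N) → ℝ,
    ContDiff ℝ 1 w ∧ (∃ x, w x ≠ 0) ∧ tsupport w ⊆ Metric.ball 0 ρ ∧
    t = (∫ x in Metric.ball (0 : EuclideanSpace ℝ (Fin N)) ρ, ‖fderiv ℝ w x‖ ^ 2) /
        (∫ x in Metric.ball (0 : EuclideanSpace ℝ (Fin N)) ρ, |w x| ^ q) ^ (2 / q)}


open Topology intervalIntegral

lemma integral_mul_eq_by_parts_primitive {p w w' : ℝ → ℝ} {x y : ℝ}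
    (hp : IntervalIntegrable p volume 0 1) (hx : 0 ≤ x) (hxy : x ≤ y) (hy : y ≤ 1)
    (hw : ∀ t ∈ Icc x y, HasDerivAt w (w' t) t) (hw' : ContinuousOn w' (Icc x y)) :
    ∫ t in x..y, p t * w t =
      (∫ s in (0:ℝ)..y, p s) * w y - (∫ s in (0:ℝ)..x, p s) * w x
        - ∫ t in x..y, (∫ s in (0:ℝ)..t, p s) * w' t := by
  have hsub : uIcc x y ⊆ uIcc (0:ℝ) 1 := by
    rw [uIcc_of_le hxy, uIcc_of_le zero_le_one]; exact Icc_subset_Icc hx hy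
  have hF : AbsolutelyContinuousOnInterval (fun t => ∫ s in (0:ℝ)..t, p s) x y :=
    (hp.absolutelyContinuousOnInterval_intervalIntegral (c := 0) (by simp)).mono hsub
  have hwA : AbsolutelyContinuousOnInterval w x y := by
    obtain ⟨C, hC⟩ := isCompact_Icc.exists_bound_of_continuousOn hw'
    have hC0 : 0 ≤ C := (norm_nonneg _).trans (hC x ⟨le_rfl, hxy⟩)
    have : LipschitzOnWith (⟨C, hC0⟩ : NNReal) w (uIcc x y) := by
      rw [uIcc_of_le hxy]
      refine (convex_Icc x y).lipschitzOnWith_of_nnnorm_hasDerivWithin_le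
        (f' := w') (fun t ht => (hw t ht).hasDerivWithinAt) (fun t ht => ?_)
      exact hC t ht
    exact this.absolutelyContinuousOnInterval
  have h := AbsolutelyContinuousOnInterval.integral_mul_deriv_eq_deriv_mul hF hwA
  have h1 : ∫ t in x..y, (∫ s in (0:ℝ)..t, p s) * deriv w t
      = ∫ t in x..y, (∫ s in (0:ℝ)..t, p s) * w' t := by
    refine integral_congr fun t ht => ?_
    rw [uIcc_of_le hxy] at ht
    simp only [(hw t ht).deriv]
  have h2 : ∫ t in x..y, deriv (fun t => ∫ s in (0:ℝ)..t, p s) t * w t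
      = ∫ t in x..y, p t * w t := by
    refine integral_congr_ae ?_
    filter_upwards [hp.ae_hasDerivAt_integral] with t ht htm
    rw [(ht (hsub (uIoc_subset_uIcc htm)) 0 (by simp)).deriv]
  rw [h1, h2] at h
  linarith

/-- `v` solves the radial equation `(r v')' = -p` in integrated form. -/
def IsRadialPrimitive (p v v' : ℝ → ℝ) : Prop :=
  ContinuousOn v (Icc 0 1) ∧ (∀ r ∈ Ioc (0:ℝ) 1, HasDerivAt v (v' r) r) ∧
  ∀ r ∈ Ioc (0:ℝ) 1, r * v' r = - ∫ s in (0:ℝ)..r, p s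

lemma intervalIntegrable_sub_unit {p : ℝ → ℝ} (hp : IntervalIntegrable p volume 0 1) {x y : ℝ}
    (hx : x ∈ Icc (0:ℝ) 1) (hy : y ∈ Icc (0:ℝ) 1) : IntervalIntegrable p volume x y := by
  refine hp.mono_set ?_
  rw [uIcc_of_le (zero_le_one' ℝ)]
  exact (convex_Icc (0:ℝ) 1).ordConnected.uIcc_subset hx hy

lemma tendsto_primitive_nhdsGT_zero {p : ℝ → ℝ} (hp : IntervalIntegrable p volume 0 1) :
    Tendsto (fun x => ∫ s in (0:ℝ)..x, p s) (𝓝[>] 0) (𝓝 0) := by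
  have hc : ContinuousOn (fun x => ∫ s in (0:ℝ)..x, p s) (uIcc 0 1) :=
    continuousOn_primitive_interval' hp (by simp)
  have h0 := hc 0 (by simp)
  rw [uIcc_of_le zero_le_one] at h0
  have h1 : Tendsto (fun x => ∫ s in (0:ℝ)..x, p s) (𝓝[Icc 0 1] 0) (𝓝 0) := by
    have h2 := h0.tendsto
    simp only [integral_same] at h2
    exact h2
  refine h1.mono_left ?_
  rw [← nhdsWithin_Ioc_eq_nhdsGT (zero_lt_one' ℝ)]
  exact nhdsWithin_mono _ Ioc_subset_Icc_self

lemma tendsto_continuousOn_nhdsGT_zero {v : ℝ → ℝ} (hv : ContinuousOn v (Icc 0 1)) :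
    Tendsto v (𝓝[>] 0) (𝓝 (v 0)) := by
  refine (hv 0 (by simp)).tendsto.mono_left ?_
  rw [← nhdsWithin_Ioc_eq_nhdsGT (zero_lt_one' ℝ)]
  exact nhdsWithin_mono _ Ioc_subset_Icc_self

lemma tendsto_integral_nhdsGT_zero {p : ℝ → ℝ} (hp : IntervalIntegrable p volume 0 1) {r : ℝ}
    (hr : r ∈ Ioc (0:ℝ) 1) :
    Tendsto (fun x => ∫ s in x..r, p s) (𝓝[>] 0) (𝓝 (∫ s in (0:ℝ)..r, p s)) := by
  have h := (tendsto_primitive_nhdsGT_zero hp).const_sub (∫ s in (0:ℝ)..r, p s)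
  rw [sub_zero] at h
  refine h.congr' ?_
  filter_upwards [Ioc_mem_nhdsGT (zero_lt_one' ℝ)] with x hx
  have h01 : (0:ℝ) ∈ Icc (0:ℝ) 1 := by simp
  rw [integral_interval_sub_left
    (intervalIntegrable_sub_unit hp h01 (Ioc_subset_Icc_self hr))
    (intervalIntegrable_sub_unit hp h01 (Ioc_subset_Icc_self hx))]

lemma IsRadialPrimitive.continuousOn_deriv {p v v' : ℝ → ℝ} (h : IsRadialPrimitive p v v')
    (hp : IntervalIntegrable p volume 0 1) : ContinuousOn v' (Ioc 0 1) := by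
  have hc : ContinuousOn (fun x => ∫ s in (0:ℝ)..x, p s) (Icc 0 1) := by
    simpa [uIcc_of_le] using continuousOn_primitive_interval' hp (by simp)
  have : ContinuousOn (fun r => (-∫ s in (0:ℝ)..r, p s) / r) (Ioc 0 1) :=
    (hc.mono Ioc_subset_Icc_self).neg.div continuousOn_id fun r hr => hr.1.ne'
  refine this.congr fun r hr => ?_
  simp only
  rw [← h.2.2 r hr, mul_div_cancel_left₀ _ hr.1.ne']

lemma IsRadialPrimitive.eq_integral {p v v' : ℝ → ℝ} (h : IsRadialPrimitive p v v')
    (hp : IntervalIntegrable p volume 0 1)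
    (hpl : IntervalIntegrable (fun t => p t * Real.log t) volume 0 1) {r : ℝ}
    (hr : r ∈ Ioc (0:ℝ) 1) :
    v r = v 0 + ∫ t in (0:ℝ)..r, p t * (Real.log t - Real.log r) := by
  have hI : IntervalIntegrable (fun t => p t * (Real.log t - Real.log r)) volume 0 1 := by
    simpa only [mul_sub] using hpl.sub (hp.mul_const _)
  have key : ∀ x ∈ Ioc 0 r, ∫ t in x..r, p t * (Real.log t - Real.log r)
      = -((∫ s in (0:ℝ)..x, p s) * Real.log x - (∫ s in (0:ℝ)..x, p s) * Real.log r)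
        + v r - v x := by
    intro x hx
    have hx1 : ∀ t ∈ Icc x r, t ∈ Ioc (0:ℝ) 1 := fun t ht =>
      ⟨hx.1.trans_le ht.1, ht.2.trans hr.2⟩
    have h1 := integral_mul_eq_by_parts_primitive (w := fun t => Real.log t - Real.log r)
      (w' := fun t => t⁻¹) hp hx.1.le hx.2 hr.2
      (fun t ht => (Real.hasDerivAt_log (hx1 t ht).1.ne').sub_const _)
      (continuousOn_inv₀.mono fun t ht => (hx1 t ht).1.ne')
    have h2 : ∫ t in x..r, v' t = v r - v x := by
      refine integral_eq_sub_of_hasDerivAt (fun t ht => ?_) ?_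
      · rw [uIcc_of_le hx.2] at ht
        exact h.2.1 t (hx1 t ht)
      · refine ContinuousOn.intervalIntegrable ?_
        rw [uIcc_of_le hx.2]
        exact (h.continuousOn_deriv hp).mono hx1
    have h3 : ∫ t in x..r, (∫ s in (0:ℝ)..t, p s) * t⁻¹ = - ∫ t in x..r, v' t := by
      rw [← intervalIntegral.integral_neg]
      refine integral_congr fun t ht => ?_
      rw [uIcc_of_le hx.2] at ht
      have h4 := h.2.2 t (hx1 t ht)
      have h5 := (hx1 t ht).1.ne'
      field_simp
      linarith
    rw [h1, h3, h2]
    ring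
  have hFl : Tendsto (fun x => (∫ s in (0:ℝ)..x, p s) * Real.log x) (𝓝[>] 0) (𝓝 0) := by
    have hn := tendsto_primitive_nhdsGT_zero hpl.norm
    refine squeeze_zero_norm' ?_ hn
    filter_upwards [Ioc_mem_nhdsGT (zero_lt_one' ℝ)] with x hx
    rw [← intervalIntegral.integral_mul_const]
    have h01 : (0:ℝ) ∈ Icc (0:ℝ) 1 := by simp
    refine (intervalIntegral.norm_integral_le_integral_norm hx.1.le).trans ?_
    refine intervalIntegral.integral_mono_on_of_le_Ioo hx.1.le ?_ ?_ ?_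
    · exact (intervalIntegrable_sub_unit (hp.mul_const _) h01 (Ioc_subset_Icc_self hx)).norm
    · exact (intervalIntegrable_sub_unit hpl h01 (Ioc_subset_Icc_self hx)).norm
    · intro t ht
      simp only [norm_mul, Real.norm_eq_abs]
      refine mul_le_mul_of_nonneg_left ?_ (abs_nonneg _)
      rw [abs_of_nonpos (Real.log_nonpos hx.1.le hx.2),
        abs_of_nonpos (Real.log_nonpos ht.1.le (ht.2.le.trans hx.2))]
      exact neg_le_neg (Real.log_le_log ht.1 ht.2.le)
  have L1 := tendsto_integral_nhdsGT_zero hI hr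
  have L2 : Tendsto (fun x => -((∫ s in (0:ℝ)..x, p s) * Real.log x
      - (∫ s in (0:ℝ)..x, p s) * Real.log r) + v r - v x) (𝓝[>] 0)
      (𝓝 (-(0 - 0 * Real.log r) + v r - v 0)) :=
    (((hFl.sub ((tendsto_primitive_nhdsGT_zero hp).mul_const _)).neg).add_const _).sub
      (tendsto_continuousOn_nhdsGT_zero h.1)
  have L3 := tendsto_nhds_unique (L1.congr' (by
    filter_upwards [Ioc_mem_nhdsGT hr.1] with x hx using key x hx)) L2
  rw [L3]; ring

lemma IsRadialPrimitive.abs_sub_le {p v v' : ℝ → ℝ} (h : IsRadialPrimitive p v v')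
    (hp : IntervalIntegrable p volume 0 1)
    (hpl : IntervalIntegrable (fun t => p t * Real.log t) volume 0 1) {r : ℝ}
    (hr : r ∈ Ioc (0:ℝ) 1) :
    |v r - v 0| ≤ ∫ t in (0:ℝ)..r, |p t| * |Real.log t| := by
  rw [h.eq_integral hp hpl hr, add_sub_cancel_left, ← Real.norm_eq_abs]
  have h01 : (0:ℝ) ∈ Icc (0:ℝ) 1 := by simp
  refine (intervalIntegral.norm_integral_le_integral_norm hr.1.le).trans ?_
  refine intervalIntegral.integral_mono_on_of_le_Ioo hr.1.le ?_ ?_ ?_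
  · refine (intervalIntegrable_sub_unit ?_ h01 (Ioc_subset_Icc_self hr)).norm
    simpa only [mul_sub] using hpl.sub (hp.mul_const _)
  · simpa only [norm_mul, Real.norm_eq_abs] using (intervalIntegrable_sub_unit hpl h01 (Ioc_subset_Icc_self hr)).norm
  · intro t ht
    simp only [norm_mul, Real.norm_eq_abs]
    refine mul_le_mul_of_nonneg_left ?_ (abs_nonneg _)
    have h1 := Real.log_le_log ht.1 ht.2.le
    have h2 := Real.log_nonpos hr.1.le hr.2
    rw [abs_of_nonpos (by linarith), abs_of_nonpos (by linarith)]
    linarith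

lemma IsRadialPrimitive.green {p q u u' v v' : ℝ → ℝ} (hu : IsRadialPrimitive p u u')
    (hv : IsRadialPrimitive q v v') (hp : IntervalIntegrable p volume 0 1)
    (hq : IntervalIntegrable q volume 0 1) (hu1 : u' 1 = 0) (hv1 : v' 1 = 0) :
    ∫ t in (0:ℝ)..1, (p t * v t - q t * u t) = 0 := by
  have h1m : (1:ℝ) ∈ Ioc (0:ℝ) 1 := by simp
  have hpv : IntervalIntegrable (fun t => p t * v t) volume 0 1 :=
    hp.mul_continuousOn (by rw [uIcc_of_le zero_le_one]; exact hv.1)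
  have hqu : IntervalIntegrable (fun t => q t * u t) volume 0 1 :=
    hq.mul_continuousOn (by rw [uIcc_of_le zero_le_one]; exact hu.1)
  have hp1 : ∫ s in (0:ℝ)..1, p s = 0 := by have := hu.2.2 1 h1m; rw [hu1] at this; linarith
  have hq1 : ∫ s in (0:ℝ)..1, q s = 0 := by have := hv.2.2 1 h1m; rw [hv1] at this; linarith
  have key : ∀ x ∈ Ioc (0:ℝ) 1, ∫ t in x..1, (p t * v t - q t * u t)
      = -((∫ s in (0:ℝ)..x, p s) * v x - (∫ s in (0:ℝ)..x, q s) * u x) := by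
    intro x hx
    have hx1 : ∀ t ∈ Icc x 1, t ∈ Ioc (0:ℝ) 1 := fun t ht => ⟨hx.1.trans_le ht.1, ht.2⟩
    have e1 := integral_mul_eq_by_parts_primitive (w := v) (w' := v') hp hx.1.le hx.2 le_rfl
      (fun t ht => hv.2.1 t (hx1 t ht)) ((hv.continuousOn_deriv hq).mono hx1)
    have e2 := integral_mul_eq_by_parts_primitive (w := u) (w' := u') hq hx.1.le hx.2 le_rfl
      (fun t ht => hu.2.1 t (hx1 t ht)) ((hu.continuousOn_deriv hp).mono hx1)
    have e3 : ∫ t in x..1, (∫ s in (0:ℝ)..t, p s) * v' t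
        = ∫ t in x..1, (∫ s in (0:ℝ)..t, q s) * u' t := by
      refine integral_congr fun t ht => ?_
      rw [uIcc_of_le hx.2] at ht
      have a1 := hu.2.2 t (hx1 t ht)
      have a2 := hv.2.2 t (hx1 t ht)
      linear_combination v' t * a1 - u' t * a2
    have hxm := Ioc_subset_Icc_self hx
    rw [intervalIntegral.integral_sub (intervalIntegrable_sub_unit hpv hxm (by simp))
      (intervalIntegrable_sub_unit hqu hxm (by simp)), e1, e2, e3, hp1, hq1]
    ring
  have L1 := tendsto_integral_nhdsGT_zero (hpv.sub hqu) h1m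
  have L2 := ((tendsto_primitive_nhdsGT_zero hp).mul (tendsto_continuousOn_nhdsGT_zero hv.1)).sub
    ((tendsto_primitive_nhdsGT_zero hq).mul (tendsto_continuousOn_nhdsGT_zero hu.1)) |>.neg
  have L3 := tendsto_nhds_unique (L1.congr' (by
    filter_upwards [Ioc_mem_nhdsGT (zero_lt_one' ℝ)] with x hx using key x hx)) L2
  simpa using L3

lemma le_mul_exp_of_le_add_integral {b : ℝ → ℝ} {G μ : ℝ} (hμ : 0 ≤ μ)
    (hb : ContinuousOn b (Icc 0 1)) (hb0 : ∀ r ∈ Icc (0:ℝ) 1, 0 ≤ b r)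
    (h : ∀ r ∈ Icc (0:ℝ) 1, b r ≤ G + μ * ∫ s in (0:ℝ)..r, b s) {r : ℝ} (hr : r ∈ Icc (0:ℝ) 1) :
    b r ≤ G * Real.exp μ := by
  have hbi : IntervalIntegrable b volume 0 1 :=
    ContinuousOn.intervalIntegrable (by rwa [uIcc_of_le zero_le_one])
  have hc : ContinuousOn (fun x => ∫ s in (0:ℝ)..x, b s) (Icc 0 1) := by
    simpa [uIcc_of_le] using continuousOn_primitive_interval' hbi (by simp)
  have hanti : AntitoneOn (fun r => (G + μ * ∫ s in (0:ℝ)..r, b s) * Real.exp (-(μ * r)))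
      (Icc 0 1) := by
    refine antitoneOn_of_hasDerivWithinAt_nonpos (f' := fun r => (μ * b r) * Real.exp (-(μ * r))
      + (G + μ * ∫ s in (0:ℝ)..r, b s) * (Real.exp (-(μ * r)) * (-(μ * 1)))) (convex_Icc 0 1)
      ?_ ?_ ?_
    · exact (continuousOn_const.add (continuousOn_const.mul hc)).mul (by fun_prop)
    · intro x hx
      rw [interior_Icc] at hx
      have hx' := Ioo_subset_Icc_self hx
      have hnb := Icc_mem_nhds hx.1 hx.2
      have hd : HasDerivAt (fun r => ∫ s in (0:ℝ)..r, b s) (b x) x :=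
        integral_hasDerivAt_right (intervalIntegrable_sub_unit hbi (by simp) hx')
          (hb.stronglyMeasurableAtFilter_nhdsWithin measurableSet_Icc x |>.filter_mono (by
            rw [nhdsWithin_eq_nhds.2 hnb])) (hb.continuousAt hnb)
      exact (((hd.const_mul μ).const_add G).mul
        (((hasDerivAt_id x).const_mul μ).neg.exp)).hasDerivWithinAt
    · intro x hx
      rw [interior_Icc] at hx
      have h1 := h x (Ioo_subset_Icc_self hx)
      have h2 : 0 ≤ μ * Real.exp (-(μ * x)) := by positivity
      nlinarith [mul_nonneg h2 (sub_nonneg.2 h1)]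
  have h1 := hanti (show (0:ℝ) ∈ Icc (0:ℝ) 1 by simp) hr hr.1
  simp only [integral_same, mul_zero, add_zero, neg_zero, Real.exp_zero, mul_one] at h1
  have h2 : G + μ * ∫ s in (0:ℝ)..r, b s ≤ G * Real.exp (μ * r) := by
    have := mul_le_mul_of_nonneg_right h1 (Real.exp_pos (μ * r)).le
    rwa [mul_assoc, ← Real.exp_add, neg_add_cancel, Real.exp_zero, mul_one] at this
  have hG : 0 ≤ G := by
    have h3 := h 0 (by simp)
    have h4 := hb0 0 (by simp)
    simp only [integral_same, mul_zero, add_zero] at h3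
    linarith
  refine (h r hr).trans (h2.trans (mul_le_mul_of_nonneg_left (Real.exp_le_exp.2 ?_) hG))
  nlinarith [hr.2]

lemma IsRadialNeumannSolutionDeriv.isRadialPrimitive {a u u' : ℝ → ℝ}
    (h : IsRadialNeumannSolutionDeriv 2 a u u') :
    IsRadialPrimitive (fun s => s * a s * u s) u u' := by
  refine ⟨h.1, h.2.1, fun r hr => ?_⟩
  simpa using h.2.2.1 r hr

lemma abs_log_mul_self_le_one {s : ℝ} (hs : s ∈ Ioc (0:ℝ) 1) : s * |Real.log s| ≤ 1 := by
  have := (Real.abs_log_mul_self_lt s hs.1 hs.2).le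
  rwa [abs_mul, abs_of_pos hs.1, mul_comm] at this

lemma intervalIntegrable_mul_log_self :
    IntervalIntegrable (fun s : ℝ => s * Real.log s) volume 0 1 :=
  Real.continuous_mul_log.intervalIntegrable 0 1

lemma radialNeumann_apply_zero_ne_zero {μ : ℝ} (hμ : 0 ≤ μ) {φ φ' : ℝ → ℝ}
    (hφ : IsRadialNeumannSolutionDeriv 2 (fun _ => μ) φ φ') (hn : NontrivialSol φ) :
    φ 0 ≠ 0 := by
  intro h0
  have hP := hφ.isRadialPrimitive
  have hc := hφ.1
  have hc' : ContinuousOn φ (uIcc 0 1) := by rwa [uIcc_of_le zero_le_one]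
  have hp : IntervalIntegrable (fun s => s * μ * φ s) volume 0 1 :=
    ContinuousOn.intervalIntegrable (by fun_prop)
  have hpl : IntervalIntegrable (fun s => s * μ * φ s * Real.log s) volume 0 1 := by
    have := (intervalIntegrable_mul_log_self.mul_continuousOn (hc')).const_mul μ
    refine this.congr fun s _ => ?_
    ring
  obtain ⟨r, hr, hr0⟩ := hn
  have hb : ∀ r ∈ Icc (0:ℝ) 1, |φ r| ≤ 0 + μ * ∫ s in (0:ℝ)..r, |φ s| := by
    intro r hr
    rcases hr.1.eq_or_lt with rfl | hr1
    · simp [h0]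
    have hr' : r ∈ Ioc (0:ℝ) 1 := ⟨hr1, hr.2⟩
    have h1 := hP.abs_sub_le hp hpl hr'
    rw [h0, sub_zero] at h1
    rw [zero_add, ← intervalIntegral.integral_const_mul]
    refine h1.trans (intervalIntegral.integral_mono_on_of_le_Ioo hr1.le ?_ ?_ ?_)
    · simpa only [norm_mul, Real.norm_eq_abs, abs_mul] using
        (intervalIntegrable_sub_unit hpl (by simp) hr).norm
    · exact (intervalIntegrable_sub_unit (ContinuousOn.intervalIntegrable hc'.abs)
        (by simp) hr).const_mul _
    · intro t ht
      have h2 := abs_log_mul_self_le_one ⟨ht.1, ht.2.le.trans hr.2⟩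
      rw [abs_mul, abs_mul, abs_of_pos ht.1, abs_of_nonneg hμ]
      nlinarith [mul_nonneg hμ (abs_nonneg (φ t))]
  have := le_mul_exp_of_le_add_integral hμ hc.abs (fun _ _ => abs_nonneg _) hb hr
  rw [zero_mul] at this
  exact hr0 (abs_nonpos_iff.1 this)

lemma intervalIntegrable_weight_mul {f g : ℝ → ℝ} (hf : Measurable f)
    (hW : IntervalIntegrable (fun s => s * (1 + |Real.log s|) ^ 2 * f s) volume 0 1)
    (hg : Measurable g) (hgb : ∀ s ∈ Ioc (0:ℝ) 1, |g s| ≤ (1 + |Real.log s|) ^ 2) :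
    IntervalIntegrable (fun s => s * f s * g s) volume 0 1 := by
  refine hW.mono_fun ((measurable_id.mul hf).mul hg).aestronglyMeasurable ?_
  filter_upwards [ae_restrict_mem measurableSet_uIoc] with s hs
  rw [uIoc_of_le zero_le_one] at hs
  simp only [Real.norm_eq_abs, abs_mul, abs_of_pos hs.1, abs_pow,
    abs_of_nonneg (add_nonneg zero_le_one (abs_nonneg (Real.log s)))]
  have := mul_le_mul_of_nonneg_left (hgb s hs) (mul_nonneg hs.1.le (abs_nonneg (f s)))
  linarith

lemma exp_neg_div_four_le_integral_weight {μ : ℝ} (hμ : 0 ≤ μ) {φ φ' : ℝ → ℝ}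
    (hφ : IsRadialNeumannSolutionDeriv 2 (fun _ => μ) φ φ') (hφn : NontrivialSol φ)
    (hz : volume {x ∈ Ioo (0:ℝ) 1 | φ x = 0} = 0) {a u u' : ℝ → ℝ} (ha : Measurable a)
    (hP : Prec μ a) (hu : IsRadialNeumannSolutionDeriv 2 a u u') (hun : NontrivialSol u)
    (hW : IntervalIntegrable (fun s => s * (1 + |Real.log s|) ^ 2 * (a s - μ)) volume 0 1) :
    Real.exp (-μ) / 4 ≤ ∫ s in (0:ℝ)..1, s * (1 + |Real.log s|) ^ 2 * (a s - μ) := by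
  by_contra! hE
  set f : ℝ → ℝ := fun s => a s - μ with hfdef
  have hfm : Measurable f := ha.sub_const μ
  set E := ∫ s in (0:ℝ)..1, s * (1 + |Real.log s|) ^ 2 * f s with hEdef
  have hf0 : ∀ᵐ s ∂(volume.restrict (Ioc (0:ℝ) 1)), 0 ≤ f s := by
    rw [← restrict_Ioo_eq_restrict_Ioc]
    filter_upwards [hP.1] with s hs using sub_nonneg.2 hs
  have hφ0 := radialNeumann_apply_zero_ne_zero hμ hφ hφn
  have hφP := hφ.isRadialPrimitive
  have huP := hu.isRadialPrimitive
  have hφc : ContinuousOn φ (uIcc 0 1) := by rw [uIcc_of_le zero_le_one]; exact hφ.1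
  have huc : ContinuousOn u (uIcc 0 1) := by rw [uIcc_of_le zero_le_one]; exact hu.1
  have hlm : Measurable fun s : ℝ => |Real.log s| :=
    continuous_abs.measurable.comp Real.measurable_log
  have I1 : IntervalIntegrable (fun s => s * f s * 1) volume 0 1 :=
    intervalIntegrable_weight_mul hfm hW measurable_const fun s _ => by
      rw [abs_one]; nlinarith [abs_nonneg (Real.log s)]
  have Il : IntervalIntegrable (fun s => s * f s * Real.log s) volume 0 1 :=
    intervalIntegrable_weight_mul hfm hW Real.measurable_log fun s _ => by
      nlinarith [abs_nonneg (Real.log s)]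
  have Ial : IntervalIntegrable (fun s => s * f s * |Real.log s|) volume 0 1 :=
    intervalIntegrable_weight_mul hfm hW hlm fun s _ => by
      rw [abs_abs]; nlinarith [abs_nonneg (Real.log s)]
  have Iw : IntervalIntegrable (fun s => s * f s * (1 + |Real.log s|)) volume 0 1 :=
    intervalIntegrable_weight_mul hfm hW (measurable_const.add hlm) fun s _ => by
      rw [abs_of_nonneg (add_nonneg zero_le_one (abs_nonneg (Real.log s)))]
      nlinarith [abs_nonneg (Real.log s)]
  have Ipu : IntervalIntegrable (fun s => s * a s * u s) volume 0 1 := by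
    refine (((intervalIntegrable_id.mul_const μ).add I1).mul_continuousOn huc).congr
      fun s _ => ?_
    simp only [hfdef]; ring
  have Ipul : IntervalIntegrable (fun s => s * a s * u s * Real.log s) volume 0 1 := by
    refine (((intervalIntegrable_mul_log_self.mul_const μ).add Il).mul_continuousOn huc).congr
      fun s _ => ?_
    simp only [hfdef]; ring
  have Ipφ : IntervalIntegrable (fun s => s * μ * φ s) volume 0 1 :=
    (intervalIntegrable_id.mul_const μ).mul_continuousOn hφc
  have Ipφl : IntervalIntegrable (fun s => s * μ * φ s * Real.log s) volume 0 1 := by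
    refine ((intervalIntegrable_mul_log_self.mul_const μ).mul_continuousOn hφc).congr
      fun s _ => ?_
    ring
  -- the difference of the two normalized solutions
  set v : ℝ → ℝ := fun r => φ 0 * u r - u 0 * φ r with hvdef
  have hvc : ContinuousOn v (Icc 0 1) :=
    (continuousOn_const.mul hu.1).sub (continuousOn_const.mul hφ.1)
  have hvc' : ContinuousOn v (uIcc 0 1) := by rwa [uIcc_of_le zero_le_one]
  set pv : ℝ → ℝ := fun s => φ 0 * (s * a s * u s) - u 0 * (s * μ * φ s) with hpvdef
  have hv0 : v 0 = 0 := by simp only [hvdef]; ring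
  have Ipv : IntervalIntegrable pv volume 0 1 := (Ipu.const_mul _).sub (Ipφ.const_mul _)
  have Ipvl : IntervalIntegrable (fun s => pv s * Real.log s) volume 0 1 := by
    refine ((Ipul.const_mul (φ 0)).sub (Ipφl.const_mul (u 0))).congr fun s _ => ?_
    simp only [hpvdef]; ring
  have hvP : IsRadialPrimitive pv v (fun r => φ 0 * u' r - u 0 * φ' r) := by
    refine ⟨hvc, fun r hr => ((hu.2.1 r hr).const_mul _).sub ((hφ.2.1 r hr).const_mul _),
      fun r hr => ?_⟩
    have hr' := Ioc_subset_Icc_self hr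
    rw [intervalIntegral.integral_sub
      ((intervalIntegrable_sub_unit Ipu (by simp) hr').const_mul _)
      ((intervalIntegrable_sub_unit Ipφ (by simp) hr').const_mul _),
      intervalIntegral.integral_const_mul, intervalIntegral.integral_const_mul]
    linear_combination φ 0 * huP.2.2 r hr - u 0 * hφP.2.2 r hr
  obtain ⟨x0, hx0, hmax⟩ := isCompact_Icc.exists_isMaxOn (by simp) hvc.abs
  set S := |v x0| with hSdef
  have hS : ∀ r ∈ Icc (0:ℝ) 1, |v r| ≤ S := fun r hr => hmax hr
  have hS0 : 0 ≤ S := abs_nonneg _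
  set K := ∫ s in (0:ℝ)..1, s * f s * (1 + |Real.log s|) * |φ s| with hKdef
  have IK : IntervalIntegrable (fun s => s * f s * (1 + |Real.log s|) * |φ s|) volume 0 1 :=
    Iw.mul_continuousOn hφc.abs
  set J := ∫ s in (0:ℝ)..1, s * f s * φ s ^ 2 with hJdef
  have IJ : IntervalIntegrable (fun s => s * f s * φ s ^ 2) volume 0 1 := by
    simpa using I1.mul_continuousOn (hφc.pow 2)
  have hmem : ∀ᵐ s ∂(volume.restrict (Ioc (0:ℝ) 1)), s ∈ Ioc (0:ℝ) 1 :=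
    ae_restrict_mem measurableSet_Ioc
  have hJ0 : 0 ≤ J := by
    rw [hJdef, integral_of_le zero_le_one]
    refine integral_nonneg_of_ae ?_
    filter_upwards [hf0, hmem] with s hs hs1
    exact mul_nonneg (mul_nonneg hs1.1.le hs) (sq_nonneg _)
  have hE0 : 0 ≤ E := by
    rw [hEdef, integral_of_le zero_le_one]
    refine integral_nonneg_of_ae ?_
    filter_upwards [hf0, hmem] with s hs hs1
    exact mul_nonneg (mul_nonneg hs1.1.le (sq_nonneg _)) hs
  have hK0 : 0 ≤ K := by
    rw [hKdef, integral_of_le zero_le_one]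
    refine integral_nonneg_of_ae ?_
    filter_upwards [hf0, hmem] with s hs hs1
    exact mul_nonneg (mul_nonneg (mul_nonneg hs1.1.le hs)
      (add_nonneg zero_le_one (abs_nonneg _))) (abs_nonneg _)
  have hKJ : K ^ 2 ≤ E * J := by
    have hq : ∀ x : ℝ, 0 ≤ E * (x * x) + (-2 * K) * x + J := by
      intro x
      have e : E * (x * x) + (-2 * K) * x + J
          = ∫ s in (0:ℝ)..1, s * f s * (x * (1 + |Real.log s|) - |φ s|) ^ 2 := by
        have e1 : (fun s => s * f s * (x * (1 + |Real.log s|) - |φ s|) ^ 2)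
            = fun s => (x * x) * (s * (1 + |Real.log s|) ^ 2 * f s)
              + (-2 * x) * (s * f s * (1 + |Real.log s|) * |φ s|) + s * f s * φ s ^ 2 := by
          funext s
          rw [← sq_abs (φ s)]; ring
        rw [e1, intervalIntegral.integral_add ((hW.const_mul _).add (IK.const_mul _)) IJ,
          intervalIntegral.integral_add (hW.const_mul _) (IK.const_mul _),
          intervalIntegral.integral_const_mul, intervalIntegral.integral_const_mul]
        ring
      rw [e, integral_of_le zero_le_one]
      refine integral_nonneg_of_ae ?_
      filter_upwards [hf0, hmem] with s hs hs1
      exact mul_nonneg (mul_nonneg hs1.1.le hs) (sq_nonneg _)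
    have := discrim_le_zero hq
    rw [discrim] at this
    nlinarith
  -- sup bound on the difference
  have hSle : S ≤ (S * E + |u 0| * K) * Real.exp μ := by
    refine le_mul_exp_of_le_add_integral (b := fun r => |v r|) hμ hvc.abs
      (fun _ _ => abs_nonneg _) ?_ hx0
    intro r hr
    rcases hr.1.eq_or_lt with rfl | hr1
    · simp only [hv0, abs_zero, integral_same, mul_zero, add_zero]
      positivity
    have h1 := hvP.abs_sub_le Ipv Ipvl ⟨hr1, hr.2⟩
    rw [hv0, sub_zero] at h1
    have hb : ∀ᵐ s ∂(volume.restrict (Ioc (0:ℝ) 1)), |pv s| * |Real.log s|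
        ≤ S * (s * (1 + |Real.log s|) ^ 2 * f s)
          + |u 0| * (s * f s * (1 + |Real.log s|) * |φ s|) + μ * |v s| := by
      filter_upwards [hf0, hmem] with s hs hs1
      have hL := abs_nonneg (Real.log s)
      have e : pv s = s * (μ * v s + f s * (v s + u 0 * φ s)) := by
        simp only [hpvdef, hvdef, hfdef]; ring
      have h2 : |pv s| ≤ s * (μ * |v s| + f s * (S + |u 0| * |φ s|)) := by
        rw [e, abs_mul, abs_of_pos hs1.1]
        refine mul_le_mul_of_nonneg_left ((abs_add_le _ _).trans ?_) hs1.1.le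
        rw [abs_mul, abs_mul, abs_of_nonneg hμ, abs_of_nonneg hs]
        refine add_le_add le_rfl (mul_le_mul_of_nonneg_left ((abs_add_le _ _).trans ?_) hs)
        rw [abs_mul]
        exact add_le_add (hS s (Ioc_subset_Icc_self hs1)) le_rfl
      have h3 := mul_le_mul_of_nonneg_right h2 hL
      have h4 := abs_log_mul_self_le_one hs1
      have h5 : s * |Real.log s| * (μ * |v s|) ≤ 1 * (μ * |v s|) :=
        mul_le_mul_of_nonneg_right h4 (mul_nonneg hμ (abs_nonneg _))
      have hsf : 0 ≤ s * f s := mul_nonneg hs1.1.le hs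
      have h6 : s * f s * S * |Real.log s| ≤ s * f s * S * (1 + |Real.log s|) ^ 2 :=
        mul_le_mul_of_nonneg_left (by nlinarith) (mul_nonneg hsf hS0)
      have h7 : s * f s * (|u 0| * |φ s|) * |Real.log s|
          ≤ s * f s * (|u 0| * |φ s|) * (1 + |Real.log s|) :=
        mul_le_mul_of_nonneg_left (by linarith)
          (mul_nonneg hsf (mul_nonneg (abs_nonneg _) (abs_nonneg _)))
      linarith
    have Ib : IntervalIntegrable (fun s => S * (s * (1 + |Real.log s|) ^ 2 * f s)
        + |u 0| * (s * f s * (1 + |Real.log s|) * |φ s|)) volume 0 1 :=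
      (hW.const_mul _).add (IK.const_mul _)
    have Iv : IntervalIntegrable (fun s => μ * |v s|) volume 0 1 :=
      (ContinuousOn.intervalIntegrable hvc'.abs).const_mul _
    have Ir : ∀ {g : ℝ → ℝ}, IntervalIntegrable g volume 0 1 →
        IntervalIntegrable g volume 0 r := fun hg => intervalIntegrable_sub_unit hg (by simp) hr
    refine h1.trans ?_
    have h2 : ∫ t in (0:ℝ)..r, |pv t| * |Real.log t|
        ≤ ∫ s in (0:ℝ)..r, (S * (s * (1 + |Real.log s|) ^ 2 * f s)
          + |u 0| * (s * f s * (1 + |Real.log s|) * |φ s|) + μ * |v s|) := by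
      refine intervalIntegral.integral_mono_ae_restrict hr1.le ?_ (Ir (Ib.add Iv)) ?_
      · simpa only [norm_mul, Real.norm_eq_abs] using (Ir Ipvl).norm
      · rw [← restrict_Ioc_eq_restrict_Icc]
        exact ae_mono (Measure.restrict_mono (Ioc_subset_Ioc_right hr.2) le_rfl) hb
    refine h2.trans ?_
    rw [intervalIntegral.integral_add (Ir Ib) (Ir Iv), intervalIntegral.integral_const_mul]
    refine add_le_add ?_ le_rfl
    have h3 : S * E + |u 0| * K = ∫ s in (0:ℝ)..1, (S * (s * (1 + |Real.log s|) ^ 2 * f s)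
        + |u 0| * (s * f s * (1 + |Real.log s|) * |φ s|)) := by
      rw [intervalIntegral.integral_add (hW.const_mul _) (IK.const_mul _),
        intervalIntegral.integral_const_mul, intervalIntegral.integral_const_mul]
    rw [h3]
    refine intervalIntegral.integral_mono_interval le_rfl hr1.le hr.2 ?_ Ib
    filter_upwards [hf0, hmem] with s hs hs1
    have hL := abs_nonneg (Real.log s)
    have hsf : 0 ≤ s * f s := mul_nonneg hs1.1.le hs
    have h4 : 0 ≤ s * (1 + |Real.log s|) ^ 2 * f s :=
      mul_nonneg (mul_nonneg hs1.1.le (sq_nonneg _)) hs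
    exact add_nonneg (mul_nonneg hS0 h4) (mul_nonneg (abs_nonneg _)
      (mul_nonneg (mul_nonneg hsf (by linarith)) (abs_nonneg _)))
  have hexp : Real.exp μ * E ≤ 1 / 4 := by
    have h1 := mul_le_mul_of_nonneg_left hE.le (Real.exp_pos μ).le
    rw [Real.exp_neg] at h1
    have h2 : Real.exp μ * ((Real.exp μ)⁻¹ / 4) = 1 / 4 := by
      have := (Real.exp_pos μ).ne'
      field_simp
    linarith
  have hS2 : S ≤ 4 / 3 * (Real.exp μ * (|u 0| * K)) := by
    have := mul_le_mul_of_nonneg_left hexp hS0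
    nlinarith
  -- Green's identity
  have hG := huP.green hφP Ipu Ipφ hu.2.2.2 hφ.2.2.2
  have hG2 : |u 0| * J ≤ S * K := by
    have Ifv : IntervalIntegrable (fun s => s * f s * φ s * v s) volume 0 1 := by
      simpa using (I1.mul_continuousOn hφc).mul_continuousOn hvc'
    have e : u 0 * J = - ∫ s in (0:ℝ)..1, s * f s * φ s * v s := by
      have e2 : φ 0 * ∫ t in (0:ℝ)..1, (t * a t * u t * φ t - t * μ * φ t * u t)
          = (∫ s in (0:ℝ)..1, s * f s * φ s * v s) + u 0 * J := by
        rw [hJdef, ← intervalIntegral.integral_const_mul, ← intervalIntegral.integral_const_mul,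
          ← intervalIntegral.integral_add Ifv (IJ.const_mul _)]
        congr 1
        funext t
        simp only [hfdef, hvdef]; ring
      rw [hG, mul_zero] at e2
      linarith
    have e3 : |u 0| * J = |∫ s in (0:ℝ)..1, s * f s * φ s * v s| := by
      rw [← abs_of_nonneg hJ0, ← abs_mul, e, abs_neg]
    rw [e3, hKdef, ← intervalIntegral.integral_const_mul, ← Real.norm_eq_abs]
    refine norm_integral_le_of_norm_le zero_le_one ?_ (IK.const_mul _)
    rw [← ae_restrict_iff' measurableSet_Ioc]
    filter_upwards [hf0, hmem] with s hs hs1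
    have hsf : 0 ≤ s * f s := mul_nonneg hs1.1.le hs
    rw [Real.norm_eq_abs, abs_mul, abs_mul, abs_of_nonneg hsf, mul_comm S]
    refine mul_le_mul ?_ (hS s (Ioc_subset_Icc_self hs1)) (abs_nonneg _) ?_
    · refine mul_le_mul_of_nonneg_right ?_ (abs_nonneg _)
      nlinarith [mul_nonneg hsf (abs_nonneg (Real.log s))]
    · exact mul_nonneg (mul_nonneg hsf (by positivity)) (abs_nonneg _)
  have hu0 : u 0 ≠ 0 := by
    intro hu0
    rw [hu0, abs_zero, zero_mul, mul_zero, mul_zero] at hS2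
    obtain ⟨r, hr, hr0⟩ := hun
    have h1 := (hS r hr).trans hS2
    have h2 := abs_nonpos_iff.1 h1
    simp only [hvdef, hu0, zero_mul, sub_zero] at h2
    exact (mul_ne_zero hφ0 hr0) h2
  have hJ : J = 0 := by
    have h1 : |u 0| * J ≤ 4 / 3 * Real.exp μ * |u 0| * (E * J) := by
      have h2 := mul_le_mul_of_nonneg_right hS2 hK0
      have h3 : 0 ≤ 4 / 3 * Real.exp μ * |u 0| := by positivity
      nlinarith [mul_le_mul_of_nonneg_left hKJ h3]
    have h4 : 0 ≤ |u 0| * J := by positivity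
    have h5 := mul_le_mul_of_nonneg_right hexp h4
    have h6 : |u 0| * J = 0 := by nlinarith
    exact (mul_eq_zero.1 h6).resolve_left (abs_ne_zero.2 hu0)
  -- conclusion
  have hae : ∀ᵐ s ∂(volume.restrict (Ioc (0:ℝ) 1)), s * f s * φ s ^ 2 = 0 := by
    rw [hJdef, integral_of_le zero_le_one] at hJ
    refine (integral_eq_zero_iff_of_nonneg_ae ?_ IJ.1).1 hJ
    filter_upwards [hf0, hmem] with s hs hs1
    exact mul_nonneg (mul_nonneg hs1.1.le hs) (sq_nonneg _)
  rw [← restrict_Ioo_eq_restrict_Ioc, ae_restrict_iff' measurableSet_Ioo] at hae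
  refine hP.2.ne' (measure_mono_null (fun s hs => ?_) (measure_union_null hz (ae_iff.1 hae)))
  by_cases hc : φ s = 0
  · exact Or.inl ⟨hs.1, hc⟩
  · refine Or.inr ?_
    simp only [mem_ofPred_eq, not_forall]
    exact ⟨hs.1, mul_ne_zero (mul_ne_zero hs.1.1.ne' (sub_pos.2 hs.2).ne') (pow_ne_zero 2 hc)⟩

lemma mul_one_add_abs_log_rpow_le {q s : ℝ} (hq : 1 ≤ q) (hs : s ∈ Ioc (0:ℝ) 1) :
    s * (1 + |Real.log s|) ^ q ≤ q ^ q := by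
  have hq0 : 0 < q := by linarith
  have hl := Real.log_nonpos hs.1.le hs.2
  rw [abs_of_nonpos hl]
  have h1 : 1 + -Real.log s ≤ q * Real.exp (-Real.log s / q) := by
    have := Real.add_one_le_exp (-Real.log s / q)
    have h2 := mul_le_mul_of_nonneg_left this hq0.le
    rw [mul_add, mul_div_cancel₀ _ hq0.ne'] at h2
    linarith
  have h2 : (1 + -Real.log s) ^ q ≤ q ^ q * s⁻¹ := by
    refine (Real.rpow_le_rpow (by linarith) h1 hq0.le).trans (le_of_eq ?_)
    rw [Real.mul_rpow hq0.le (Real.exp_pos _).le, ← Real.exp_mul, div_mul_cancel₀ _ hq0.ne',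
      Real.exp_neg, Real.exp_log hs.1]
  calc s * (1 + -Real.log s) ^ q ≤ s * (q ^ q * s⁻¹) := mul_le_mul_of_nonneg_left h2 hs.1.le
    _ = q ^ q := by have := hs.1.ne'; field_simp

lemma omegaN_two_pos : 0 < omegaN 2 := by
  have : 0 < (volume (Metric.ball (0 : EuclideanSpace ℝ (Fin 2)) 1)).toReal :=
    ENNReal.toReal_pos (Metric.measure_ball_pos _ _ one_pos).ne' measure_ball_lt_top.ne
  unfold omegaN
  positivity

lemma exists_pos_le_radialLpNorm {μ : ℝ} (hμ : 0 ≤ μ) {φ : ℝ → ℝ}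
    (hφ : IsRadialNeumannSolution 2 (fun _ => μ) φ) (hφn : NontrivialSol φ)
    (hz : volume {x ∈ Ioo (0:ℝ) 1 | φ x = 0} = 0) {p : ℝ} (hp : 1 < p) :
    ∃ c > 0, ∀ a : ℝ → ℝ, GammaSet 2 μ a → RadialMemLp 2 p a →
      c ≤ radialLpNorm 2 p (fun r => a r - μ) := by
  obtain ⟨φ', hφ⟩ := hφ
  have hp0 : 0 < p := by linarith
  obtain ⟨q, hpq⟩ : ∃ q, p.HolderConjugate q := ⟨_, Real.HolderConjugate.conjExponent hp⟩
  have hq1 : 1 < q := hpq.symm.lt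
  have hq0 : 0 < q := hpq.symm.pos
  set B := (2 * q) ^ (2 * q) with hBdef
  have hB : 0 < B := Real.rpow_pos_of_pos (by linarith) _
  set κ := Real.exp (-μ) / 8 with hκdef
  have hκ : 0 < κ := by positivity
  set η := (q * κ / B) ^ (1 / q) with hηdef
  have hη : 0 < η := Real.rpow_pos_of_pos (by positivity) _
  have hηq : η ^ q = q * κ / B := by
    rw [hηdef, ← Real.rpow_mul (by positivity), one_div_mul_cancel hq0.ne', Real.rpow_one]
  refine ⟨(omegaN 2 * (p * η ^ p * κ)) ^ (1 / p), ?_, fun a ha hap => ?_⟩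
  · have := omegaN_two_pos
    have := Real.rpow_pos_of_pos hη p
    positivity
  obtain ⟨ham, hprec, ⟨u, ⟨u', hu⟩, hun⟩, -⟩ := ha
  have hf0 : ∀ᵐ s ∂(volume.restrict (Ioc (0:ℝ) 1)), 0 ≤ a s - μ := by
    rw [← restrict_Ioo_eq_restrict_Ioc]
    filter_upwards [hprec.1] with s hs using sub_nonneg.2 hs
  have hmem : ∀ᵐ s ∂(volume.restrict (Ioc (0:ℝ) 1)), s ∈ Ioc (0:ℝ) 1 :=
    ae_restrict_mem measurableSet_Ioc
  have If : IntervalIntegrable (fun s => s * |a s - μ| ^ p) volume 0 1 := by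
    rw [RadialMemLp, ← integrableOn_Ioc_iff_integrableOn_Ioo,
      ← intervalIntegrable_iff_integrableOn_Ioc_of_le zero_le_one] at hap
    refine hap.mono_fun (Measurable.aestronglyMeasurable (by fun_prop)) ?_
    rw [uIoc_of_le zero_le_one]
    filter_upwards [hf0, hmem] with s hs hs1
    have h1 : |a s - μ| ^ p ≤ |a s| ^ p := by
      refine Real.rpow_le_rpow (abs_nonneg _) ?_ hp0.le
      rw [abs_of_nonneg hs, abs_of_nonneg (by linarith)]
      linarith
    have h2 : 0 ≤ |a s - μ| ^ p := by positivity
    simp only [Real.norm_eq_abs, Nat.reduceSub, pow_one, abs_mul, abs_of_pos hs1.1,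
      abs_of_nonneg h2, abs_of_nonneg (h2.trans h1)]
    exact mul_le_mul_of_nonneg_left h1 hs1.1.le
  have Ig : IntervalIntegrable (fun s => κ + 1 / (p * η ^ p) * (s * |a s - μ| ^ p)) volume 0 1 :=
    intervalIntegrable_const.add (If.const_mul _)
  have hbound : ∀ᵐ s ∂(volume.restrict (Ioc (0:ℝ) 1)),
      s * (1 + |Real.log s|) ^ 2 * (a s - μ) ≤ κ + 1 / (p * η ^ p) * (s * |a s - μ| ^ p) := by
    filter_upwards [hf0, hmem] with s hs hs1
    have hL := abs_nonneg (Real.log s)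
    have hY := Real.young_inequality_of_nonneg (a := (a s - μ) / η)
      (b := η * (1 + |Real.log s|) ^ 2) (by positivity) (by positivity) hpq
    have e1 : (a s - μ) / η * (η * (1 + |Real.log s|) ^ 2)
        = (1 + |Real.log s|) ^ 2 * (a s - μ) := by field_simp
    have e2 : (η * (1 + |Real.log s|) ^ 2) ^ q / q
        = κ / B * (1 + |Real.log s|) ^ (2 * q) := by
      rw [Real.mul_rpow hη.le (by positivity), hηq, ← Real.rpow_natCast, ← Real.rpow_mul
        (by positivity)]
      push_cast
      field_simp
    have e3 : ((a s - μ) / η) ^ p / p = 1 / (p * η ^ p) * |a s - μ| ^ p := by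
      rw [Real.div_rpow hs hη.le, abs_of_nonneg hs]
      field_simp
    rw [e1, e2, e3] at hY
    have h2 := mul_one_add_abs_log_rpow_le (q := 2 * q) (by linarith) hs1
    have h3 := mul_le_mul_of_nonneg_left hY hs1.1.le
    have h4 : κ / B * (s * (1 + |Real.log s|) ^ (2 * q)) ≤ κ := by
      calc _ ≤ κ / B * B := mul_le_mul_of_nonneg_left h2 (by positivity)
        _ = κ := by field_simp
    linarith
  have hW : IntervalIntegrable (fun s => s * (1 + |Real.log s|) ^ 2 * (a s - μ)) volume 0 1 := by
    have hm : Measurable fun s : ℝ => |Real.log s| :=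
      continuous_abs.measurable.comp Real.measurable_log
    refine Ig.mono_fun (Measurable.aestronglyMeasurable (by fun_prop)) ?_
    rw [uIoc_of_le zero_le_one]
    filter_upwards [hbound, hf0, hmem] with s hs hs0 hs1
    rw [Real.norm_of_nonneg (mul_nonneg (mul_nonneg hs1.1.le (sq_nonneg _)) hs0)]
    exact hs.trans (Real.le_norm_self _)
  have h1 := exp_neg_div_four_le_integral_weight hμ hφ hφn hz ham hprec hu hun hW
  have h2 : ∫ s in (0:ℝ)..1, s * (1 + |Real.log s|) ^ 2 * (a s - μ)
      ≤ κ + 1 / (p * η ^ p) * ∫ s in (0:ℝ)..1, s * |a s - μ| ^ p := by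
    have h3 := intervalIntegral.integral_mono_ae_restrict zero_le_one hW Ig (by
      rw [← restrict_Ioc_eq_restrict_Icc]; exact hbound)
    rw [intervalIntegral.integral_add intervalIntegrable_const (If.const_mul _),
      intervalIntegral.integral_const_mul] at h3
    simpa using h3
  have h4 : κ ≤ 1 / (p * η ^ p) * ∫ s in (0:ℝ)..1, s * |a s - μ| ^ p := by
    have : Real.exp (-μ) / 4 = κ + κ := by rw [hκdef]; ring
    linarith
  have hηp : 0 < p * η ^ p := mul_pos hp0 (Real.rpow_pos_of_pos hη p)
  have h5 : p * η ^ p * κ ≤ ∫ s in (0:ℝ)..1, s * |a s - μ| ^ p := by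
    have := mul_le_mul_of_nonneg_left h4 hηp.le
    rwa [← mul_assoc, mul_one_div_cancel hηp.ne', one_mul] at this
  have hω := omegaN_two_pos
  simp only [radialLpNorm, Nat.reduceSub, pow_one]
  exact Real.rpow_le_rpow (by positivity) (mul_le_mul_of_nonneg_left h5 hω.le) (by positivity)

lemma exists_pos_le_radialLinftyNorm {μ : ℝ} (hμ : 0 ≤ μ) {φ : ℝ → ℝ}
    (hφ : IsRadialNeumannSolution 2 (fun _ => μ) φ) (hφn : NontrivialSol φ)
    (hz : volume {x ∈ Ioo (0:ℝ) 1 | φ x = 0} = 0) :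
    ∃ c > 0, ∀ a : ℝ → ℝ, GammaSet 2 μ a → RadialMemLinfty a →
      c ≤ radialLinftyNorm (fun r => a r - μ) := by
  obtain ⟨φ', hφ⟩ := hφ
  refine ⟨Real.exp (-μ) / 16, by positivity, fun a ha hab => ?_⟩
  obtain ⟨ham, hprec, ⟨u, ⟨u', hu⟩, hun⟩, -⟩ := ha
  obtain ⟨C, hC⟩ := hab
  set t := radialLinftyNorm (fun r => a r - μ) with ht
  have hle : ∀ᵐ s ∂(volume.restrict (Ioc (0:ℝ) 1)), |a s - μ| ≤ t := by
    rw [← restrict_Ioo_eq_restrict_Ioc]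
    refine _root_.ae_le_essSup ⟨C + |μ|, ?_⟩
    rw [eventually_map]
    filter_upwards [hC] with s hs
    exact (abs_sub _ _).trans (add_le_add hs le_rfl)
  have hf0 : ∀ᵐ s ∂(volume.restrict (Ioc (0:ℝ) 1)), 0 ≤ a s - μ := by
    rw [← restrict_Ioo_eq_restrict_Ioc]
    filter_upwards [hprec.1] with s hs using sub_nonneg.2 hs
  have hmem : ∀ᵐ s ∂(volume.restrict (Ioc (0:ℝ) 1)), s ∈ Ioc (0:ℝ) 1 :=
    ae_restrict_mem measurableSet_Ioc
  have hbound : ∀ᵐ s ∂(volume.restrict (Ioc (0:ℝ) 1)),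
      s * (1 + |Real.log s|) ^ 2 * (a s - μ) ≤ 4 * t := by
    filter_upwards [hle, hf0, hmem] with s hs hs0 hs1
    have h2 := mul_one_add_abs_log_rpow_le (q := 2) (by norm_num) hs1
    have h3 : (2:ℝ) ^ (2:ℝ) = 4 := by norm_num
    rw [h3, Real.rpow_two] at h2
    exact mul_le_mul h2 ((le_abs_self _).trans hs) hs0 (by norm_num)
  have hW : IntervalIntegrable (fun s => s * (1 + |Real.log s|) ^ 2 * (a s - μ)) volume 0 1 := by
    have hm : Measurable fun s : ℝ => |Real.log s| :=
      continuous_abs.measurable.comp Real.measurable_log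
    refine (intervalIntegrable_const (c := 4 * t)).mono_fun
      (Measurable.aestronglyMeasurable (by fun_prop)) ?_
    rw [uIoc_of_le zero_le_one]
    filter_upwards [hbound, hf0, hmem] with s hs hs0 hs1
    rw [Real.norm_of_nonneg (mul_nonneg (mul_nonneg hs1.1.le (sq_nonneg _)) hs0)]
    exact hs.trans (Real.le_norm_self _)
  have h1 := exp_neg_div_four_le_integral_weight hμ hφ hφn hz ham hprec hu hun hW
  have h2 := intervalIntegral.integral_mono_ae_restrict zero_le_one hW
    (intervalIntegrable_const (c := 4 * t)) (by
      rw [← restrict_Ioc_eq_restrict_Icc]; exact hbound)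
  rw [intervalIntegral.integral_const, sub_zero, one_smul] at h2
  linarith

lemma exists_smooth_step {α β : ℝ} (hαβ : α < β) :
    ∃ s d : ℝ → ℝ, (∀ r, HasDerivAt s (d r) r) ∧ Continuous d ∧ (∀ r, 0 ≤ d r) ∧
      (∀ r, 0 ≤ s r) ∧ (∀ r, s r ≤ 1) ∧ (∀ r ≤ α, s r = 0) ∧ (∀ r, β ≤ r → s r = 1) ∧
      (∀ r ≤ α, d r = 0) ∧ (∀ r, β ≤ r → d r = 0) := by
  have hβα : 0 < β - α := sub_pos.2 hαβ
  set s : ℝ → ℝ := fun r => Real.smoothTransition ((r - α) / (β - α)) with hs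
  have hsm : ContDiff ℝ 1 s :=
    Real.smoothTransition.contDiff.comp ((contDiff_id.sub contDiff_const).div_const _)
  have hmono : Monotone s := fun x y hxy =>
    Real.smoothTransition.monotone (by gcongr)
  have h0 : ∀ r ≤ α, s r = 0 := fun r hr => Real.smoothTransition.zero_of_nonpos
    (div_nonpos_of_nonpos_of_nonneg (sub_nonpos.2 hr) hβα.le)
  have h1 : ∀ r, β ≤ r → s r = 1 := fun r hr => Real.smoothTransition.one_of_one_le
    ((one_le_div hβα).2 (by linarith))
  have hn : ∀ r, 0 ≤ s r := fun r => Real.smoothTransition.nonneg _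
  have hl : ∀ r, s r ≤ 1 := fun r => Real.smoothTransition.le_one _
  refine ⟨s, deriv s, fun r => (hsm.differentiable (by norm_num) r).hasDerivAt,
    hsm.continuous_deriv (by norm_num), fun r => hmono.deriv_nonneg, hn, hl, h0, h1,
    fun r hr => ?_, fun r hr => ?_⟩
  · exact IsLocalMin.deriv_eq_zero (Eventually.of_forall fun y => by rw [h0 r hr]; exact hn y)
  · exact IsLocalMax.deriv_eq_zero (Eventually.of_forall fun y => by rw [h1 r hr]; exact hl y)

lemma exists_radial_profile {Φ : ℝ → ℝ} (hΦ : Continuous Φ) {c C ρ ε : ℝ} (hc0 : 0 < c)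
    (hC0 : 0 < C) (hρ0 : 0 < ρ) (hρ1 : ρ ≤ 1) (hε : 0 < ε) (hερ : ε ≤ ρ * c / 4)
    (hc : ∀ r ∈ Icc 0 ρ, c ≤ Φ r ^ 2) (hC : ∀ r ∈ Icc 0 ρ, Φ r ^ 2 ≤ C) :
    ∃ (δ : ℝ) (w w' h z f : ℝ → ℝ), 0 < δ ∧ (∀ r, HasDerivAt w (w' r) r) ∧
      (∀ r ≤ δ, w r = 0) ∧ (∀ r, ρ ≤ r → w r = 0) ∧
      (∀ r ≤ δ, w' r = 0) ∧ (∀ r, ρ ≤ r → w' r = 0) ∧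
      Continuous h ∧ (∀ r, h r = w r / (r * Φ r ^ 2)) ∧ (∀ r, HasDerivAt z (h r) r) ∧
      z 0 ≤ -1 ∧ Measurable f ∧ (∀ r ∈ Ioc (0:ℝ) 1, 0 ≤ f r) ∧
      (∃ B, ∀ r ∈ Ioc (0:ℝ) 1, f r ≤ B) ∧
      (∀ r ∈ Ioc (0:ℝ) 1, r * f r * Φ r ^ 2 * z r = -w' r) ∧
      (∫ r in (0:ℝ)..1, r * f r ≤ 4 * ε / c) ∧ 0 < volume {r ∈ Ioo (0:ℝ) 1 | 0 < f r} := by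
  set δ := ρ / 4 * Real.exp (-(2 * C / ε)) with hδ
  have hδ0 : 0 < δ := by positivity
  have hδρ : 4 * δ ≤ ρ := by
    have : Real.exp (-(2 * C / ε)) ≤ 1 := Real.exp_le_one_iff.2 (by
      rw [neg_nonpos]; positivity)
    rw [hδ]
    nlinarith
  obtain ⟨s₁, d₁, hsd₁, hdc₁, hd₁, hs₁, hs₁', hz₁, ho₁, hdl₁, hdr₁⟩ :=
    exists_smooth_step (show δ < 2 * δ by linarith)
  obtain ⟨s₂, d₂, hsd₂, hdc₂, hd₂, hs₂, hs₂', hz₂, ho₂, hdl₂, hdr₂⟩ :=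
    exists_smooth_step (show ρ / 2 < ρ by linarith)
  set w : ℝ → ℝ := fun r => ε * (s₁ r - s₂ r) with hw
  set w' : ℝ → ℝ := fun r => ε * (d₁ r - d₂ r) with hw'
  have hww : ∀ r, HasDerivAt w (w' r) r := fun r => ((hsd₁ r).sub (hsd₂ r)).const_mul ε
  have hwc : Continuous w := continuous_iff_continuousAt.2 fun r => (hww r).continuousAt
  have hwl : ∀ r ≤ δ, w r = 0 := fun r hr => by
    simp only [hw]; rw [hz₁ r hr, hz₂ r (by linarith)]; ring
  have hwr : ∀ r, ρ ≤ r → w r = 0 := fun r hr => by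
    simp only [hw]; rw [ho₁ r (by linarith), ho₂ r hr]; ring
  have hwl' : ∀ r ≤ δ, w' r = 0 := fun r hr => by
    simp only [hw']; rw [hdl₁ r hr, hdl₂ r (by linarith)]; ring
  have hwr' : ∀ r, ρ ≤ r → w' r = 0 := fun r hr => by
    simp only [hw']; rw [hdr₁ r (by linarith), hdr₂ r hr]; ring
  have hw0 : ∀ r, 0 ≤ w r := fun r => by
    refine mul_nonneg hε.le ?_
    rcases le_total r (2 * δ) with h | h
    · rw [hz₂ r (by linarith)]; linarith [hs₁ r]
    · rw [ho₁ r h]; linarith [hs₂' r]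
  have hwε : ∀ r, w r ≤ ε := fun r => by
    have : s₁ r - s₂ r ≤ 1 := by linarith [hs₁' r, hs₂ r]
    simp only [hw]; nlinarith
  have hwm : ∀ r, 2 * δ ≤ r → r ≤ ρ / 2 → w r = ε := fun r h1 h2 => by
    simp only [hw]; rw [ho₁ r h1, hz₂ r h2]; ring
  set h : ℝ → ℝ := fun r => w r / (r * Φ r ^ 2) with hh
  have hden : ∀ r ∈ Icc δ ρ, 0 < r * Φ r ^ 2 := fun r hr =>
    mul_pos (hδ0.trans_le hr.1) (hc0.trans_le (hc r ⟨hδ0.le.trans hr.1, hr.2⟩))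
  have hhc : Continuous h := by
    refine continuous_iff_continuousAt.2 fun r => ?_
    rcases lt_or_ge r δ with h1 | h1
    · refine (continuousAt_const (y := (0:ℝ))).congr ?_
      filter_upwards [Iio_mem_nhds h1] with x hx
      simp only [hh]; rw [hwl x (le_of_lt hx), zero_div]
    rcases lt_or_ge ρ r with h2 | h2
    · refine (continuousAt_const (y := (0:ℝ))).congr ?_
      filter_upwards [Ioi_mem_nhds h2] with x hx
      simp only [hh]; rw [hwr x (le_of_lt hx), zero_div]
    exact hwc.continuousAt.div (by fun_prop) (hden r ⟨h1, h2⟩).ne'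
  have hh0 : ∀ r, 0 ≤ r → 0 ≤ h r := fun r hr =>
    div_nonneg (hw0 r) (mul_nonneg hr (sq_nonneg _))
  set z : ℝ → ℝ := fun r => 1 + ∫ t in (1:ℝ)..r, h t with hzdef
  have hzd : ∀ r, HasDerivAt z (h r) r := fun r =>
    (integral_hasDerivAt_right (hhc.intervalIntegrable _ _)
      hhc.stronglyMeasurable.stronglyMeasurableAtFilter hhc.continuousAt).const_add 1
  have hzc : Continuous z := continuous_iff_continuousAt.2 fun r => (hzd r).continuousAt
  have hzsub : ∀ x y, z y - z x = ∫ t in x..y, h t := fun x y => by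
    simp only [hzdef]
    rw [add_sub_add_left_eq_sub,
      integral_interval_sub_left (hhc.intervalIntegrable _ _) (hhc.intervalIntegrable _ _)]
  have hz1 : z 1 = 1 := by simp [hzdef]
  have hzmono : ∀ x y, 0 ≤ x → x ≤ y → z x ≤ z y := fun x y hx hxy => by
    have h1 := hzsub x y
    have h2 : 0 ≤ ∫ t in x..y, h t :=
      intervalIntegral.integral_nonneg hxy fun t ht => hh0 t (hx.trans ht.1)
    linarith
  have hzup : ∀ r, ρ / 2 ≤ r → r ≤ 1 → 1 / 2 ≤ z r := fun r hr hr1 => by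
    have h1 := hzsub (ρ / 2) 1
    have h2 : ∫ t in (ρ / 2)..1, h t ≤ ∫ t in (ρ / 2)..1, (1 / 2 : ℝ) := by
      refine intervalIntegral.integral_mono_on (by linarith) (hhc.intervalIntegrable _ _)
        intervalIntegrable_const fun t ht => ?_
      rcases le_total ρ t with h3 | h3
      · simp only [hh]; rw [hwr t h3, zero_div]; norm_num
      · simp only [hh]
        have h5 : ρ / 2 * c ≤ t * Φ t ^ 2 :=
          mul_le_mul ht.1 (hc t ⟨by linarith [ht.1], h3⟩) hc0.le (by linarith [ht.1])
        rw [div_le_iff₀ (by nlinarith)]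
        linarith [hwε t]
    rw [intervalIntegral.integral_const, smul_eq_mul] at h2
    have h3 := hzmono (ρ / 2) r (by linarith) hr
    nlinarith
  have hzlow : ∀ r, 0 ≤ r → r ≤ 2 * δ → z r ≤ -1 := fun r hr0 hr => by
    have h1 := hzsub (2 * δ) (ρ / 2)
    have h2 : ∫ t in (2 * δ)..(ρ / 2), ε / C * t⁻¹ ≤ ∫ t in (2 * δ)..(ρ / 2), h t := by
      refine intervalIntegral.integral_mono_on (by linarith) ?_ (hhc.intervalIntegrable _ _)
        fun t ht => ?_
      · refine ContinuousOn.intervalIntegrable (continuousOn_const.mul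
          (continuousOn_inv₀.mono fun t ht => ?_))
        rw [uIcc_of_le (by linarith)] at ht
        exact (show 0 < t by linarith [ht.1]).ne'
      · have ht0 : 0 < t := by linarith [ht.1]
        have h3 := hden t ⟨by linarith [ht.1], by linarith [ht.2]⟩
        simp only [hh]
        rw [hwm t ht.1 ht.2, ← div_eq_mul_inv, div_div]
        refine div_le_div_of_nonneg_left hε.le h3 ?_
        rw [mul_comm C]
        exact mul_le_mul_of_nonneg_left (hC t ⟨ht0.le, by linarith [ht.2]⟩) ht0.le
    have h4 : ∫ t in (2 * δ)..(ρ / 2), ε / C * t⁻¹ = 2 := by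
      rw [intervalIntegral.integral_const_mul, integral_inv_of_pos (by linarith) (by linarith)]
      have h5 : ρ / 2 / (2 * δ) = Real.exp (2 * C / ε) := by
        rw [hδ, Real.exp_neg]
        have := (Real.exp_pos (2 * C / ε)).ne'
        field_simp
        ring
      rw [h5, Real.log_exp]
      field_simp
    have h6 := hzmono (ρ / 2) 1 (by linarith) (by linarith)
    have h7 := hzmono r (2 * δ) hr0 hr
    linarith
  set f : ℝ → ℝ := fun r => -w' r / (r * Φ r ^ 2 * z r) with hf
  have hwc' : Continuous w' := continuous_const.mul (hdc₁.sub hdc₂)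
  have hfm : Measurable f :=
    hwc'.neg.measurable.div ((continuous_id.mul (hΦ.pow 2)).mul hzc).measurable
  have hfz : ∀ r, w' r = 0 → f r = 0 := fun r hr => by simp only [hf]; rw [hr]; simp
  have hfact : ∀ r ∈ Ioc (0:ℝ) 1, (0 ≤ r * f r ∧ r * f r ≤ 2 * ε / c * (d₁ r + d₂ r)) ∧
      r * f r * Φ r ^ 2 * z r = -w' r ∧ (r ≤ 2 * δ → 0 < d₁ r → 0 < f r) := by
    intro r hr
    have hK : 0 ≤ 2 * ε / c * (d₁ r + d₂ r) :=
      mul_nonneg (by positivity) (add_nonneg (hd₁ r) (hd₂ r))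
    by_cases hzero : w' r = 0
    · rw [hfz r hzero, hzero]
      refine ⟨by simpa using hK, by simp, fun h1 h2 => ?_⟩
      simp only [hw'] at hzero
      rw [hdl₂ r (by linarith), sub_zero] at hzero
      exact absurd hzero (mul_pos hε h2).ne'
    have hrδ : δ ≤ r := le_of_not_ge fun hle => hzero (hwl' r hle)
    have hrρ : r ≤ ρ := le_of_not_ge fun hle => hzero (hwr' r hle)
    have hdenr := hden r ⟨hrδ, hrρ⟩
    have hcr := hc r ⟨hr.1.le, hrρ⟩
    have hΦr : 0 < Φ r ^ 2 := hc0.trans_le hcr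
    have hr0 := hr.1.ne'
    have hrf : r * f r = -w' r / (Φ r ^ 2 * z r) := by
      simp only [hf]; field_simp
    rcases le_or_gt r (2 * δ) with h1 | h1
    · have hzr := hzlow r hr.1.le h1
      have hd2 := hdl₂ r (by linarith)
      have e : r * f r = ε * d₁ r / (Φ r ^ 2 * -z r) := by
        rw [hrf]; simp only [hw']; rw [hd2, sub_zero, mul_neg, div_neg, neg_div]
      have hzpos : 0 < Φ r ^ 2 * -z r := mul_pos hΦr (by linarith)
      refine ⟨⟨?_, ?_⟩, ?_, fun _ h2 => ?_⟩
      · rw [e]; exact div_nonneg (mul_nonneg hε.le (hd₁ r)) hzpos.le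
      · rw [e, hd2, add_zero, div_le_iff₀ hzpos]
        have h3 : c ≤ Φ r ^ 2 * -z r := by nlinarith
        calc ε * d₁ r ≤ 2 * ε / c * d₁ r * c := by
              have : 2 * ε / c * d₁ r * c = 2 * (ε * d₁ r) := by field_simp
              rw [this]
              linarith [mul_nonneg hε.le (hd₁ r)]
          _ ≤ _ := mul_le_mul_of_nonneg_left h3 (mul_nonneg (by positivity) (hd₁ r))
      · have : z r ≠ 0 := by linarith
        rw [hrf, mul_assoc, div_mul_cancel₀ _ (mul_ne_zero hΦr.ne' this)]
      · have h4 : 0 < r * f r := by rw [e]; exact div_pos (mul_pos hε h2) hzpos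
        exact pos_of_mul_pos_right h4 hr.1.le
    · have hd1 := hdr₁ r h1.le
      have hr2 : ρ / 2 ≤ r := le_of_not_ge fun hle => hzero (by
        simp only [hw']; rw [hd1, hdl₂ r hle]; ring)
      have hzr := hzup r hr2 hr.2
      have e : r * f r = ε * d₂ r / (Φ r ^ 2 * z r) := by
        rw [hrf]; simp only [hw']; rw [hd1, zero_sub, mul_neg, neg_neg]
      have hzpos : 0 < Φ r ^ 2 * z r := mul_pos hΦr (by linarith)
      refine ⟨⟨?_, ?_⟩, ?_, fun h2 _ => absurd h2 (not_le.2 h1)⟩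
      · rw [e]; exact div_nonneg (mul_nonneg hε.le (hd₂ r)) hzpos.le
      · rw [e, hd1, zero_add, div_le_iff₀ hzpos]
        have h3 : c / 2 ≤ Φ r ^ 2 * z r := by nlinarith
        calc ε * d₂ r = 2 * ε / c * d₂ r * (c / 2) := by field_simp
          _ ≤ _ := mul_le_mul_of_nonneg_left h3 (mul_nonneg (by positivity) (hd₂ r))
      · have : z r ≠ 0 := by linarith
        rw [hrf, mul_assoc, div_mul_cancel₀ _ (mul_ne_zero hΦr.ne' this)]
  refine ⟨δ, w, w', h, z, f, hδ0, hww, hwl, hwr, hwl', hwr', hhc, fun _ => rfl, hzd,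
    hzlow 0 le_rfl (by linarith), hfm, fun r hr => ?_, ?_, fun r hr => (hfact r hr).2.1, ?_, ?_⟩
  · exact nonneg_of_mul_nonneg_right (hfact r hr).1.1 hr.1
  · obtain ⟨D, hD⟩ := isCompact_Icc.exists_bound_of_continuousOn
      (hdc₁.add hdc₂).continuousOn (s := Icc (0:ℝ) 1)
    have hD0 : 0 ≤ D := (norm_nonneg _).trans (hD 0 (by simp))
    refine ⟨2 * ε / c * D / δ, fun r hr => ?_⟩
    rcases le_total r δ with h1 | h1
    · rw [hfz r (hwl' r h1)]; positivity
    · rw [le_div_iff₀ hδ0]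
      have h2 := hfact r hr
      have h3 := nonneg_of_mul_nonneg_right h2.1.1 hr.1
      have h4 := (le_abs_self _).trans (hD r (Ioc_subset_Icc_self hr))
      have h5 : 2 * ε / c * (d₁ r + d₂ r) ≤ 2 * ε / c * D :=
        mul_le_mul_of_nonneg_left h4 (by positivity)
      nlinarith [h2.1.2]
  · have Ic : IntervalIntegrable (fun r => 2 * ε / c * (d₁ r + d₂ r)) volume 0 1 :=
      (continuous_const.mul (hdc₁.add hdc₂)).intervalIntegrable _ _
    have Irf : IntervalIntegrable (fun r => r * f r) volume 0 1 := by
      refine Ic.mono_fun (measurable_id.mul hfm).aestronglyMeasurable ?_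
      rw [uIoc_of_le zero_le_one]
      filter_upwards [ae_restrict_mem measurableSet_Ioc] with r hr
      have h1 := (hfact r hr).1
      rw [Real.norm_of_nonneg h1.1]
      exact h1.2.trans (Real.le_norm_self _)
    have h1 := intervalIntegral.integral_mono_on_of_le_Ioo zero_le_one Irf Ic
      fun r hr => (hfact r (Ioo_subset_Ioc_self hr)).1.2
    refine h1.trans (le_of_eq ?_)
    rw [intervalIntegral.integral_const_mul, intervalIntegral.integral_add
      (hdc₁.intervalIntegrable _ _) (hdc₂.intervalIntegrable _ _),
      integral_eq_sub_of_hasDerivAt (fun r _ => hsd₁ r) (hdc₁.intervalIntegrable _ _),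
      integral_eq_sub_of_hasDerivAt (fun r _ => hsd₂ r) (hdc₂.intervalIntegrable _ _),
      ho₁ 1 (by linarith), ho₂ 1 hρ1, hz₁ 0 hδ0.le, hz₂ 0 (by linarith)]
    ring
  · obtain ⟨x, hx, hxd⟩ := exists_hasDerivAt_eq_slope s₁ d₁ (show δ < 2 * δ by linarith)
      (fun r _ => (hsd₁ r).continuousAt.continuousWithinAt) (fun r _ => hsd₁ r)
    rw [ho₁ _ le_rfl, hz₁ _ le_rfl] at hxd
    have hxpos : 0 < d₁ x := by
      rw [hxd]; exact div_pos (by norm_num) (by linarith)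
    have hopen : IsOpen (Ioo δ (2 * δ) ∩ {r | 0 < d₁ r}) :=
      isOpen_Ioo.inter (isOpen_lt continuous_const hdc₁)
    refine (hopen.measure_pos volume ⟨x, hx, hxpos⟩).trans_le (measure_mono ?_)
    rintro r ⟨hr, hrd⟩
    have hr1 : r ∈ Ioo (0:ℝ) 1 := ⟨hδ0.trans hr.1, by linarith [hr.2]⟩
    exact ⟨hr1, (hfact r (Ioo_subset_Ioc_self hr1)).2.2 hr.2.le hrd⟩


lemma exists_gammaSet_integral_le {μ : ℝ} (hμ : 0 ≤ μ) {φ : ℝ → ℝ}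
    (hφ : IsRadialNeumannSolution 2 (fun _ => μ) φ) (hφn : NontrivialSol φ) {η : ℝ}
    (hη : 0 < η) :
    ∃ a : ℝ → ℝ, GammaSet 2 μ a ∧ (∃ C, ∀ r ∈ Ioc (0:ℝ) 1, |a r| ≤ C) ∧
      ∫ r in (0:ℝ)..1, r * |a r - μ| ≤ η := by
  obtain ⟨φ', hφ⟩ := hφ
  have hφ0 := radialNeumann_apply_zero_ne_zero hμ hφ hφn
  set Φ : ℝ → ℝ := IccExtend (zero_le_one' ℝ) ((Icc 0 1).domRestrict φ) with hΦdef
  have hΦc : Continuous Φ := (continuousOn_iff_continuous_domRestrict.1 hφ.1).Icc_extend'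
  have hΦφ : ∀ r ∈ Icc (0:ℝ) 1, Φ r = φ r := fun r hr => by
    simp [hΦdef, IccExtend_of_mem _ _ hr]
  have hΦd : ∀ r ∈ Ioo (0:ℝ) 1, HasDerivAt Φ (φ' r) r := fun r hr =>
    (hφ.2.1 r (Ioo_subset_Ioc_self hr)).congr_of_eventuallyEq <| by
      filter_upwards [Ioo_mem_nhds hr.1 hr.2] with x hx
      exact hΦφ x (Ioo_subset_Icc_self hx)
  set c := φ 0 ^ 2 / 2 with hc
  have hc0 : 0 < c := by positivity
  have hΦ0 : Φ 0 = φ 0 := hΦφ 0 (by simp)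
  obtain ⟨ρ, hρ0, hρ1, hcρ⟩ : ∃ ρ : ℝ, 0 < ρ ∧ ρ ≤ 1 ∧ ∀ r ∈ Icc 0 ρ, c ≤ Φ r ^ 2 := by
    have hev : ∀ᶠ r in 𝓝 (0:ℝ), c < Φ r ^ 2 :=
      (hΦc.pow 2).continuousAt.eventually (lt_mem_nhds (by
        rw [Pi.pow_apply, hΦ0, hc]; exact half_lt_self (by positivity)))
    obtain ⟨d, hd, hball⟩ := Metric.eventually_nhds_iff.1 hev
    refine ⟨min (d / 2) 1, by positivity, min_le_right _ _, fun r hr => (hball ?_).le⟩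
    rw [Real.dist_eq, sub_zero, abs_of_nonneg hr.1]
    linarith [hr.2, min_le_left (d / 2) 1]
  obtain ⟨C, hC⟩ := isCompact_Icc.exists_bound_of_continuousOn
    (hΦc.pow 2).continuousOn (s := Icc (0:ℝ) ρ)
  have hCρ : ∀ r ∈ Icc 0 ρ, Φ r ^ 2 ≤ C := fun r hr => (le_abs_self _).trans (hC r hr)
  have hC0 : 0 < C := hc0.trans_le ((hcρ 0 (by simp [hρ0.le])).trans (hCρ 0 (by simp [hρ0.le])))
  obtain ⟨δ, w, w', h, z, f, hδ, hw, hwl, hwr, hwl', hwr', hhc, hhw, hz, hz0, hfm, hf0,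
    ⟨B, hB⟩, hfz, hfi, hfpos⟩ := exists_radial_profile hΦc hc0 hC0 hρ0 hρ1
      (ε := min (ρ * c / 4) (c * η / 4)) (by positivity) (min_le_left _ _) hcρ hCρ
  have hzc : Continuous z := continuous_iff_continuousAt.2 fun r => (hz r).continuousAt
  have hab : ∀ r ∈ Ioc (0:ℝ) 1, |μ + f r| ≤ μ + B := fun r hr => by
    rw [abs_of_nonneg (add_nonneg hμ (hf0 r hr))]
    linarith [hB r hr]
  have hQφ : ∀ r ∈ Icc (0:ℝ) 1, -∫ s in (0:ℝ)..r, s * μ * Φ s = r * φ' r := fun r hr => by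
    rcases hr.1.eq_or_lt with rfl | h0
    · simp
    rw [hφ.isRadialPrimitive.2.2 r ⟨h0, hr.2⟩]
    congr 1
    refine intervalIntegral.integral_congr fun s hs => ?_
    rw [uIcc_of_le hr.1] at hs
    simp only [hΦφ s ⟨hs.1, hs.2.trans hr.2⟩]
  have hpc : Continuous fun s => s * μ * Φ s := by fun_prop
  set R : ℝ → ℝ := fun r => (-∫ s in (0:ℝ)..r, s * μ * Φ s) * z r + r * Φ r * h r with hR
  have hQd : ∀ r, HasDerivAt (fun r => -∫ s in (0:ℝ)..r, s * μ * Φ s) (-(r * μ * Φ r)) r :=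
    fun r => (integral_hasDerivAt_right (hpc.intervalIntegrable _ _)
      hpc.stronglyMeasurable.stronglyMeasurableAtFilter hpc.continuousAt).neg
  have hRc : Continuous R := by
    have : Continuous (fun r => -∫ s in (0:ℝ)..r, s * μ * Φ s) :=
      continuous_iff_continuousAt.2 fun r => (hQd r).continuousAt
    fun_prop
  have hRd : ∀ r ∈ Ioo (0:ℝ) 1, HasDerivAt R (-(r * (μ + f r) * (Φ r * z r))) r := by
    intro r hr
    have hr0 := hr.1.ne'
    have e := hfz r (Ioo_subset_Ioc_self hr)
    have hQr := hQφ r (Ioo_subset_Icc_self hr)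
    have h1 := (hQd r).mul (hz r)
    rcases le_or_gt r ρ with hle | hlt
    · have hΦr : Φ r ≠ 0 := fun h => by
        have := hcρ r ⟨hr.1.le, hle⟩
        rw [h] at this
        norm_num at this
        linarith
      have hG : HasDerivAt (fun r => r * Φ r * h r)
          ((w' r * Φ r - w r * φ' r) / Φ r ^ 2) r := by
        refine ((hw r).div (hΦd r hr) hΦr).congr_of_eventuallyEq ?_
        filter_upwards [hΦc.continuousAt.eventually_ne hΦr, lt_mem_nhds hr.1] with x hx hx0
        rw [hhw, Pi.div_apply]
        have := hx0.ne'
        field_simp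
      refine (h1.add hG).congr_deriv ?_
      simp only [hQr, hhw]
      rw [← neg_eq_iff_eq_neg] at e
      rw [← e]
      field_simp
      ring
    · have hG : HasDerivAt (fun r => r * Φ r * h r) 0 r := by
        refine (hasDerivAt_const r (0:ℝ)).congr_of_eventuallyEq ?_
        filter_upwards [lt_mem_nhds hlt] with x hx
        rw [hhw, hwr x (le_of_lt hx)]
        simp
      refine (h1.add hG).congr_deriv ?_
      rw [hhw, hwr r hlt.le]
      rw [hwr' r hlt.le] at e
      have e2 : f r * (Φ r * z r) = 0 := by
        rcases eq_or_ne (Φ r) 0 with h0 | h0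
        · simp [h0]
        · have : (r * Φ r) * (f r * (Φ r * z r)) = 0 := by linear_combination e
          exact (mul_eq_zero.1 this).resolve_left (mul_ne_zero hr0 h0)
      linear_combination r * e2
  have hint : IntervalIntegrable (fun r => -(r * (μ + f r) * (Φ r * z r))) volume 0 1 := by
    have h1 : IntervalIntegrable (fun r => r * (Φ r * z r) * (μ + B)) volume 0 1 :=
      Continuous.intervalIntegrable (by fun_prop) _ _
    refine h1.mono_fun ?_ ?_
    · exact ((measurable_id.mul (hfm.const_add μ)).mul
        (hΦc.mul hzc).measurable).neg.aestronglyMeasurable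
    · rw [uIoc_of_le zero_le_one]
      filter_upwards [ae_restrict_mem measurableSet_Ioc] with r hr
      have h2 := (hab r hr).trans (le_abs_self _)
      rw [Real.norm_eq_abs, Real.norm_eq_abs, abs_neg, abs_mul, abs_mul, abs_mul _ (μ + B),
        abs_mul r, mul_right_comm]
      gcongr
  have hReq : ∀ r ∈ Ioc (0:ℝ) 1, R r = -∫ s in (0:ℝ)..r, s * (μ + f s) * (Φ s * z s) := by
    intro r hr
    have h1 := integral_eq_sub_of_hasDerivAt_of_le hr.1.le hRc.continuousOn
      (fun x hx => hRd x ⟨hx.1, hx.2.trans_le hr.2⟩)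
      (intervalIntegrable_sub_unit hint (by simp) (Ioc_subset_Icc_self hr))
    rw [intervalIntegral.integral_neg] at h1
    rw [h1]
    simp [hR]
  have hh1 : h 1 = 0 := by rw [hhw, hwr 1 hρ1, zero_div]
  refine ⟨fun r => μ + f r, ⟨hfm.const_add μ, ⟨?_, ?_⟩, ⟨fun r => φ r * z r,
    ⟨fun r => φ' r * z r + φ r * h r, hφ.1.mul hzc.continuousOn,
      fun r hr => (hφ.2.1 r hr).mul (hz r), fun r hr => ?_, ?_⟩, 0, by simp, ?_⟩, ?_⟩,
      ⟨μ + B, hab⟩, ?_⟩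
  · filter_upwards [ae_restrict_mem measurableSet_Ioo] with r hr
    linarith [hf0 r (Ioo_subset_Ioc_self hr)]
  · simpa using hfpos
  · have h1 := hReq r hr
    have h2 : ∫ s in (0:ℝ)..r, s ^ (2 - 1) * (μ + f s) * (φ s * z s)
        = ∫ s in (0:ℝ)..r, s * (μ + f s) * (Φ s * z s) := by
      refine intervalIntegral.integral_congr fun s hs => ?_
      rw [uIcc_of_le hr.1.le] at hs
      simp only [hΦφ s ⟨hs.1, hs.2.trans hr.2⟩]
      norm_num
    rw [h2, ← h1, hR]
    simp only
    rw [hQφ r (Ioc_subset_Icc_self hr), hΦφ r (Ioc_subset_Icc_self hr)]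
    norm_num
    ring
  · simp [hφ.2.2.2, hh1]
  · exact mul_ne_zero hφ0 (by linarith)
  · rw [if_neg (by norm_num)]
    right
    refine ⟨μ + B, ?_⟩
    filter_upwards [ae_restrict_mem measurableSet_Ioo] with r hr
    exact hab r (Ioo_subset_Ioc_self hr)
  · have h1 : ∫ r in (0:ℝ)..1, r * |μ + f r - μ| = ∫ r in (0:ℝ)..1, r * f r := by
      refine intervalIntegral.integral_congr fun s hs => ?_
      rw [uIcc_of_le zero_le_one] at hs
      rcases hs.1.eq_or_lt with rfl | h0
      · simp
      · simp [abs_of_nonneg (hf0 s ⟨h0, hs.2⟩)]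
    rw [h1]
    refine hfi.trans ?_
    rw [div_le_iff₀ hc0]
    linarith [min_le_right (ρ * c / 4) (c * η / 4)]

lemma radialMemLp_of_bounded {p : ℝ} (hp : 0 ≤ p) {a : ℝ → ℝ} (ha : Measurable a) {C : ℝ}
    (hC : ∀ r ∈ Ioc (0:ℝ) 1, |a r| ≤ C) : RadialMemLp 2 p a := by
  refine Measure.integrableOn_of_bounded (M := C ^ p) (by simp)
    ((measurable_id.pow_const _).mul (ha.abs.pow_const p)).aestronglyMeasurable ?_
  filter_upwards [ae_restrict_mem measurableSet_Ioo] with r hr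
  have h1 := hC r (Ioo_subset_Ioc_self hr)
  have h2 : |a r| ^ p ≤ C ^ p := Real.rpow_le_rpow (abs_nonneg _) h1 hp
  have h3 : 0 ≤ |a r| ^ p := by positivity
  rw [Real.norm_of_nonneg (mul_nonneg (pow_nonneg hr.1.le _) h3)]
  norm_num
  nlinarith [hr.1, hr.2]

/-- For `N = 2` and any radial Neumann eigenpair of index `k`, the Lyapunov
constant `γ_{p,k}` is strictly positive iff `1 < p ≤ ∞` (in particular `γ_{1,k} = 0`). -/
theorem stmt0 (k : ℕ) (μk : ℝ) (φk : ℝ → ℝ) (rz : ℕ → ℝ)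
    (hek : IsRadialNeumannEigenpair 2 k μk φk rz) :
    (∀ p : ℝ, 1 ≤ p → (0 < gammaLyap 2 μk p ↔ 1 < p)) ∧
    0 < gammaLyapInfty 2 μk := by
  obtain ⟨hμ, hφ, hφn, -, -, hzero, -⟩ := hek
  have hz : volume {x ∈ Ioo (0:ℝ) 1 | φk x = 0} = 0 := by
    refine Set.Finite.measure_zero (((Finset.Icc 1 k).finite_toSet.image rz).subset ?_) _
    rintro x ⟨hx, hx0⟩
    obtain ⟨i, h1, h2, rfl⟩ := (hzero x hx).1 hx0
    exact ⟨i, by simp [h1, h2], rfl⟩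
  obtain ⟨a, ha, ⟨C, haC⟩, -⟩ := exists_gammaSet_integral_le hμ hφ hφn one_pos
  refine ⟨fun p hp => ⟨fun hpos => ?_, fun hp1 => ?_⟩, ?_⟩
  · refine lt_of_le_of_ne hp ?_
    rintro rfl
    refine hpos.not_ge (le_of_forall_pos_le_add fun ε hε => ?_)
    obtain ⟨b, hb, ⟨D, hbD⟩, hbi⟩ := exists_gammaSet_integral_le hμ hφ hφn
      (div_pos hε omegaN_two_pos)
    have hle : gammaLyap 2 μk 1 ≤ radialLpNorm 2 1 (fun r => b r - μk) := by
      refine csInf_le ⟨0, ?_⟩ ⟨b, hb, radialMemLp_of_bounded zero_le_one hb.1 hbD, rfl⟩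
      rintro _ ⟨g, -, -, rfl⟩
      refine Real.rpow_nonneg (mul_nonneg omegaN_two_pos.le
        (intervalIntegral.integral_nonneg zero_le_one fun r hr => ?_)) _
      exact mul_nonneg (pow_nonneg hr.1 _) (Real.rpow_nonneg (abs_nonneg _) _)
    refine hle.trans ?_
    simp only [radialLpNorm, div_one, Real.rpow_one, zero_add]
    norm_num
    rwa [mul_comm, ← le_div_iff₀ omegaN_two_pos]
  · obtain ⟨c, hc, hle⟩ := exists_pos_le_radialLpNorm hμ hφ hφn hz hp1
    refine hc.trans_le (le_csInf
      ⟨_, a, ha, radialMemLp_of_bounded (by linarith) ha.1 haC, rfl⟩ ?_)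
    rintro _ ⟨g, hg, hgp, rfl⟩
    exact hle g hg hgp
  · obtain ⟨c, hc, hle⟩ := exists_pos_le_radialLinftyNorm hμ hφ hφn hz
    refine hc.trans_le (le_csInf ⟨_, a, ha, ⟨C, ?_⟩, rfl⟩ ?_)
    · filter_upwards [ae_restrict_mem measurableSet_Ioo] with r hr
      exact haC r (Ioo_subset_Ioc_self hr)
    · rintro _ ⟨g, hg, hgp, rfl⟩
      exact hle g hg hgp
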